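/- Let u ∈ H¹(R^d) with ‖u‖_{L²}^{1−s}‖∇u‖_{L²}^{s} ≤ ‖u_Q‖_{L²}^{1−s}‖∇u_Q‖_{L²}^{s} (i.e., G_u ≤ 1). Then (s/d)‖∇u‖_{L²}² ≤ E[u] ≤ (1/2)‖∇u‖_{L²}². -/

import Mathlib

open MeasureTheory

noncomputable section

abbrev Ed (d : ℕ) := EuclideanSpace ℝ (Fin d)

def massI (d : ℕ) (f : Ed d → ℂ) : ℝ := ∫ x : Ed d, ‖f x‖ ^ 2

def gradI (d : ℕ) (f : Ed d → ℂ) : ℝ := ∫ x : Ed d, ‖fderiv ℝ f x‖ ^ 2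

def potI (d : ℕ) (p : ℝ) (f : Ed d → ℂ) : ℝ := ∫ x : Ed d, ‖f x‖ ^ (p + 1)

def energyI (d : ℕ) (p : ℝ) (f : Ed d → ℂ) : ℝ :=
  (1 / 2) * gradI d f - (1 / (p + 1)) * potI d p f

/-- Comparison of energy and gradient: if
`‖u‖_{L²}^{1−s}‖∇u‖_{L²}^{s} ≤ ‖u_Q‖_{L²}^{1−s}‖∇u_Q‖_{L²}^{s}` (i.e. `G_u ≤ 1`), then
`(s/d)‖∇u‖_{L²}² ≤ E[u] ≤ (1/2)‖∇u‖_{L²}²`. -/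
theorem energy_gradient_comparison (d : ℕ) (p s α : ℝ) (hd : 1 ≤ d) (hp : 1 < p)
    (hs : s = (d : ℝ) / 2 - 2 / (p - 1)) (hs0 : 0 < s) (hs1 : s < 1)
    (hα : α = Real.sqrt ((d : ℝ) * (p - 1)) / 2)
    (qn : ℝ) (hqn : 0 < qn)  -- qn = ‖Q‖_{L²}
    (CGN : ℝ) (hCGN : CGN = (p + 1) / (2 * qn ^ (p - 1)))
    (nQ : ℝ) (hnQ : nQ = α ^ (-(2 / (p - 1))) * qn)  -- ‖u_Q‖_{L²}^{1−s}‖∇u_Q‖_{L²}^{s}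
    (u : Ed d → ℂ)
    (hGN : potI d p u
      ≤ CGN * (gradI d u) ^ ((d : ℝ) * (p - 1) / 4)
          * (massI d u) ^ ((2 - ((d : ℝ) - 2) * (p - 1) / 2) / 2))
    (hGu : (massI d u) ^ ((1 - s) / 2) * (gradI d u) ^ (s / 2) ≤ nQ) :
    (s / d) * gradI d u ≤ energyI d p u ∧ energyI d p u ≤ (1 / 2) * gradI d u := by
  have hG : 0 ≤ gradI d u := integral_nonneg fun x => by positivity
  have hM : 0 ≤ massI d u := integral_nonneg fun x => by positivity
  have hP : 0 ≤ potI d p u := integral_nonneg fun x => by positivity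
  unfold energyI
  generalize gradI d u = G at *
  generalize massI d u = M at *
  generalize potI d p u = P at *
  have hp1 : 0 < p - 1 := by linarith
  have hd0 : (0 : ℝ) < d := by exact_mod_cast hd
  have hpp : 0 < p + 1 := by linarith
  have hdp : 0 < (d : ℝ) * (p - 1) := by positivity
  have hα0 : 0 < α := by rw [hα]; positivity
  have hα2 : α ^ (2 : ℝ) = (d : ℝ) * (p - 1) / 4 := by
    rw [hα, Real.rpow_two, div_pow, Real.sq_sqrt hdp.le]; norm_num
  have hsp : s * (p - 1) = (d : ℝ) * (p - 1) / 2 - 2 := by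
    rw [hs]; field_simp
  have hq0 : 0 < qn ^ (p - 1) := Real.rpow_pos_of_pos hqn _
  have e1 : (d : ℝ) * (p - 1) / 4 = 1 + s / 2 * (p - 1) := by linarith
  have e2 : (2 - ((d : ℝ) - 2) * (p - 1) / 2) / 2 = (1 - s) / 2 * (p - 1) := by
    linarith
  have hpow : (M ^ ((1 - s) / 2) * G ^ (s / 2)) ^ (p - 1) ≤ nQ ^ (p - 1) :=
    Real.rpow_le_rpow (by positivity) hGu hp1.le
  rw [Real.mul_rpow (by positivity) (by positivity), ← Real.rpow_mul hM,
    ← Real.rpow_mul hG] at hpow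
  have hn : nQ ^ (p - 1) = qn ^ (p - 1) / ((d : ℝ) * (p - 1) / 4) := by
    rw [hnQ, Real.mul_rpow (by positivity) hqn.le, ← Real.rpow_mul hα0.le]
    have : -(2 / (p - 1)) * (p - 1) = -2 := by field_simp
    rw [this, Real.rpow_neg hα0.le, hα2]
    field_simp
  rw [hn] at hpow
  have hkey : P / (p + 1) ≤ G * (2 / ((d : ℝ) * (p - 1))) := by
    rw [e1, e2, Real.rpow_add_of_nonneg hG (by norm_num) (by positivity),
      Real.rpow_one, hCGN] at hGN
    rw [div_le_iff₀ hpp]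
    calc P ≤ _ := hGN
      _ = (p + 1) / (2 * qn ^ (p - 1)) * G *
          (M ^ ((1 - s) / 2 * (p - 1)) * G ^ (s / 2 * (p - 1))) := by ring
      _ ≤ (p + 1) / (2 * qn ^ (p - 1)) * G *
          (qn ^ (p - 1) / ((d : ℝ) * (p - 1) / 4)) := by gcongr
      _ = _ := by field_simp; ring
  have hsd : s / d = 1 / 2 - 2 / ((d : ℝ) * (p - 1)) := by
    rw [hs]; field_simp
  have e3 : 1 / (p + 1) * P = P / (p + 1) := by ring
  have : 0 ≤ P / (p + 1) := by positivity
  rw [e3, hsd]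
  constructor
  · linarith
  · linarith
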